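/- Every derivation D of W(2) leaves the subspaces S₂ and W₂ invariant, i.e., D(S₂) ⊆ S₂ and D(W₂) ⊆ W₂. -/

import Mathlib

set_option maxSynthPendingDepth 3

/-- The 2-dimensional vector space `V₂ = F²`, with standard basis `v₁ = (1,0)`, `v₂ = (0,1)`. -/
abbrev V2 (F : Type*) [Field F] := Fin 2 → F

/-- The fixed vector `v₁` (the first standard basis vector of `V₂`). -/
noncomputable def v1 (F : Type*) [Field F] : V2 F := Pi.single 0 1

/-- `W(2)`: the space of all bilinear multiplications on `V₂`. -/
abbrev Wtwo (F : Type*) [Field F] := V2 F →ₗ[F] V2 F →ₗ[F] V2 F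

variable {F : Type*} [Field F]

/-- The Kantor product on `W(2)`:
`(A·B)(x,y) = A(v₁, B(x,y)) − B(A(v₁,x), y) − B(x, A(v₁,y))`. -/
noncomputable def wmul (A B : Wtwo F) : Wtwo F :=
  LinearMap.mk₂ F
    (fun x y => A (v1 F) (B x y) - B (A (v1 F) x) y - B x (A (v1 F) y))
    (fun x x' y => by simp only [map_add, LinearMap.add_apply]; abel)
    (fun c x y => by simp only [map_smul, LinearMap.smul_apply, smul_sub])
    (fun x y y' => by simp only [map_add, LinearMap.add_apply]; abel)
    (fun c x y => by simp only [map_smul, LinearMap.smul_apply, smul_sub])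

/-- The multiplication `α^k_{i,j}` determined by `α^k_{i,j}(v_t, v_l) = δ_{it} δ_{jl} v_k`
(indices `0, 1` correspond to `1, 2` in the paper). -/
noncomputable def alph (k i j : Fin 2) : Wtwo F :=
  LinearMap.mk₂ F
    (fun x y => (x i * y j) • (Pi.single k 1 : V2 F))
    (fun x x' y => by simp [add_mul, add_smul])
    (fun c x y => by simp [smul_smul, mul_assoc])
    (fun x y y' => by simp [mul_add, add_smul])
    (fun c x y => by simp [smul_smul]; ring_nf)

noncomputable def e1 (F : Type*) [Field F] : Wtwo F := alph 0 0 0 - alph 1 0 1 - alph 1 1 0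

noncomputable def e2 (F : Type*) [Field F] : Wtwo F := alph 1 0 0

noncomputable def e3 (F : Type*) [Field F] : Wtwo F := alph 1 1 1 - alph 0 0 1 - alph 0 1 0

noncomputable def e4 (F : Type*) [Field F] : Wtwo F := alph 0 1 1

noncomputable def e5 (F : Type*) [Field F] : Wtwo F := (2 : F) • alph 0 0 0 + alph 1 0 1 + alph 1 1 0

noncomputable def e6 (F : Type*) [Field F] : Wtwo F := (2 : F) • alph 1 1 1 + alph 0 0 1 + alph 0 1 0


/-- A derivation of `W(2)`: a linear map satisfying the Leibniz rule. -/
def IsDerivation (D : Wtwo F →ₗ[F] Wtwo F) : Prop :=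
  ∀ x y : Wtwo F, D (wmul x y) = wmul (D x) y + wmul x (D y)

/-- `S2` as a subspace of `W(2)`. -/
noncomputable def S2 (F : Type*) [Field F] : Submodule F (Wtwo F) :=
  Submodule.span F {e1 F, e2 F, e3 F, e4 F}

/-- `W2sub` as a subspace of `W(2)`. -/
noncomputable def W2sub (F : Type*) [Field F] : Submodule F (Wtwo F) :=
  Submodule.span F {e1 F, e2 F, e3 F, e4 F, e5 F, e6 F}

/-- The structure constants of a multiplication on `V₂`: `entry B a b l` is the coefficient of
the `l`-th basis vector in the product of the `a`-th and the `b`-th one. -/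
noncomputable def entry (B : Wtwo F) (a b l : Fin 2) : F :=
  B (Pi.single a 1) (Pi.single b 1) l

theorem Wtwo.ext_entry {A B : Wtwo F} (h : ∀ a b l, entry A a b l = entry B a b l) : A = B := by
  ext a b l
  simpa [entry] using h a b l

@[simp] theorem entry_add (A B : Wtwo F) (a b l : Fin 2) :
    entry (A + B) a b l = entry A a b l + entry B a b l := by
  simp [entry]

@[simp] theorem entry_sub (A B : Wtwo F) (a b l : Fin 2) :
    entry (A - B) a b l = entry A a b l - entry B a b l := by
  simp [entry]

@[simp] theorem entry_smul (c : F) (A : Wtwo F) (a b l : Fin 2) :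
    entry (c • A) a b l = c * entry A a b l := by
  simp [entry]

@[simp] theorem entry_alph (k i j a b l : Fin 2) :
    entry (alph k i j : Wtwo F) a b l = if i = a ∧ j = b ∧ k = l then 1 else 0 := by
  fin_cases k <;> fin_cases i <;> fin_cases j <;> fin_cases a <;> fin_cases b <;>
    fin_cases l <;> simp [entry, alph]

theorem map_eq_single_add_single {M : Type*} [AddCommGroup M] [Module F M]
    (f : V2 F →ₗ[F] M) (x : V2 F) :
    f x = x 0 • f (Pi.single 0 1) + x 1 • f (Pi.single 1 1) := by
  rw [← map_smul, ← map_smul, ← map_add]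
  congr 1
  ext i
  fin_cases i <;> simp

@[simp] theorem entry_wmul (A B : Wtwo F) (a b l : Fin 2) :
    entry (wmul A B) a b l =
      (entry B a b 0 * entry A 0 0 l + entry B a b 1 * entry A 0 1 l)
      - (entry A 0 a 0 * entry B 0 b l + entry A 0 a 1 * entry B 1 b l)
      - (entry A 0 b 0 * entry B a 0 l + entry A 0 b 1 * entry B a 1 l) := by
  simp only [entry, wmul, v1, LinearMap.mk₂_apply, Pi.sub_apply]
  rw [map_eq_single_add_single (A (Pi.single 0 1)) (B (Pi.single a 1) (Pi.single b 1)),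
    map_eq_single_add_single B (A (Pi.single 0 1) (Pi.single a 1)),
    map_eq_single_add_single (B (Pi.single a 1)) (A (Pi.single 0 1) (Pi.single b 1))]
  simp

/-- The left multiplication by `A` determines `A(v₁, ·)`. -/
theorem entry_zero_eq_zero_of_wmul_eq_zero {A : Wtwo F} (h : ∀ B, wmul A B = 0) (b l : Fin 2) :
    entry A 0 b l = 0 := by
  have key := congrArg (fun C => entry C b 0 0) (h (alph 0 l 0 + alph 1 l 1))
  have h0 (b : Fin 2) : entry (0 : Wtwo F) b 0 0 = 0 := by simp [entry]
  fin_cases b <;> fin_cases l <;> simpa [h0] using key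

theorem IsDerivation.entry_zero_eq {D : Wtwo F →ₗ[F] Wtwo F} (hD : IsDerivation D) (A : Wtwo F)
    (b l : Fin 2) :
    entry (D A) 0 b l =
      entry A 0 0 0 * entry (D (alph 0 0 0)) 0 b l + entry A 0 0 1 * entry (D (alph 1 0 0)) 0 b l
      + entry A 0 1 0 * entry (D (alph 0 0 1)) 0 b l
      + entry A 0 1 1 * entry (D (alph 1 0 1)) 0 b l := by
  set A' : Wtwo F := entry A 0 0 0 • alph 0 0 0 + entry A 0 0 1 • alph 1 0 0
    + entry A 0 1 0 • alph 0 0 1 + entry A 0 1 1 • alph 1 0 1 with hA'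
  have hz (C : Wtwo F) : wmul (A - A') C = 0 := by
    apply Wtwo.ext_entry
    intro a b l
    have h0 : entry (0 : Wtwo F) a b l = 0 := by simp [entry]
    rw [h0]
    fin_cases a <;> fin_cases b <;> fin_cases l <;> simp [hA']
  have h := entry_zero_eq_zero_of_wmul_eq_zero (A := D (A - A')) (fun C => by
    have := hD (A - A') C
    rw [hz, hz, map_zero, add_zero] at this
    exact this.symm) b l
  rw [map_sub, entry_sub, sub_eq_zero] at h
  rw [h, hA']
  simp

/-- Every derivation of `W(2)` is a left multiplication. -/
theorem IsDerivation.exists_eq_wmul [CharZero F] {D : Wtwo F →ₗ[F] Wtwo F}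
    (hD : IsDerivation D) : ∃ A : Wtwo F, ∀ B, D B = wmul A B := by
  have key (i j : Fin 2) (B : Wtwo F) (k l : Fin 2) :=
    (hD.entry_zero_eq (wmul (alph i 0 j) B) k l).symm.trans
      (congrArg (fun C => entry C 0 k l) (hD (alph i 0 j) B))
  have h00 (k l) := key 0 1 (alph 0 0 0) k l
  have h01 (k l) := key 0 1 (alph 1 0 0) k l
  have h02 (k l) := key 0 1 (alph 0 0 1) k l
  have h10 (k l) := key 1 1 (alph 0 0 0) k l
  have h11 (k l) := key 1 1 (alph 1 0 0) k l
  have h12 (k l) := key 1 1 (alph 0 0 1) k l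
  simp only [Fin.forall_fin_two] at h00 h01 h02 h10 h11 h12
  simp at h00 h01 h02 h10 h11 h12
  refine ⟨entry (D (alph 1 0 1)) 0 1 0 • alph 0 0 1
    - entry (D (alph 0 0 1)) 0 1 0 • alph 1 0 1, fun B => Wtwo.ext_entry fun a b l => ?_⟩
  have hB := hD.entry_zero_eq B
  have h (k l) := key 1 0 B k l
  simp only [Fin.forall_fin_two] at h hB
  simp at h
  fin_cases a <;> fin_cases b <;> fin_cases l <;> simp <;> grind

theorem mem_S2_of_entry {B : Wtwo F} (h : ∀ l, entry B 0 1 l = entry B 1 0 l)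
    (h' : ∀ a, entry B a 0 0 + entry B a 1 1 = 0) : B ∈ S2 F := by
  have : B = entry B 0 0 0 • e1 F + entry B 0 0 1 • e2 F + entry B 1 1 1 • e3 F
      + entry B 1 1 0 • e4 F := by
    have := h 0; have := h 1; have := h' 0; have := h' 1
    apply Wtwo.ext_entry
    intro a b l
    fin_cases a <;> fin_cases b <;> fin_cases l <;> simp [e1, e2, e3, e4] <;> grind
  rw [this]
  refine add_mem (add_mem (add_mem ?_ ?_) ?_) ?_ <;>
    exact Submodule.smul_mem _ _ (Submodule.subset_span (by simp))

theorem mem_W2sub_of_entry [CharZero F] {B : Wtwo F} (h : ∀ l, entry B 0 1 l = entry B 1 0 l) :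
    B ∈ W2sub F := by
  set s := (entry B 0 0 0 + entry B 0 1 1) / 3 with hs
  set t := (entry B 1 1 1 + entry B 0 1 0) / 3 with ht
  have : B = (entry B 0 0 0 - 2 * s) • e1 F + entry B 0 0 1 • e2 F
      + (entry B 1 1 1 - 2 * t) • e3 F + entry B 1 1 0 • e4 F + s • e5 F + t • e6 F := by
    have := h 0; have := h 1
    apply Wtwo.ext_entry
    intro a b l
    fin_cases a <;> fin_cases b <;> fin_cases l <;> simp [e1, e2, e3, e4, e5, e6] <;> grind
  rw [this]
  refine add_mem (add_mem (add_mem (add_mem (add_mem ?_ ?_) ?_) ?_) ?_) ?_ <;>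
    exact Submodule.smul_mem _ _ (Submodule.subset_span (by simp))

theorem wmul_mem_S2 (A : Wtwo F) {x : Wtwo F}
    (hx : x ∈ ({e1 F, e2 F, e3 F, e4 F} : Set (Wtwo F))) : wmul A x ∈ S2 F := by
  simp only [Set.mem_insert_iff, Set.mem_singleton_iff] at hx
  rcases hx with rfl | rfl | rfl | rfl <;> apply mem_S2_of_entry <;> intro l <;> fin_cases l <;>
    simp [e1, e2, e3, e4]

theorem wmul_mem_W2sub [CharZero F] (A : Wtwo F) {x : Wtwo F}
    (hx : x ∈ ({e1 F, e2 F, e3 F, e4 F, e5 F, e6 F} : Set (Wtwo F))) : wmul A x ∈ W2sub F := by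
  simp only [Set.mem_insert_iff, Set.mem_singleton_iff] at hx
  rcases hx with rfl | rfl | rfl | rfl | rfl | rfl <;> apply mem_W2sub_of_entry <;> intro l <;>
    fin_cases l <;> simp [e1, e2, e3, e4, e5, e6]

/-- Every derivation of `W(2)` leaves the subspaces `S₂` and `W₂` invariant. -/
theorem derivation_invariant_subspaces {F : Type*} [Field F] [CharZero F]
    (D : Wtwo F →ₗ[F] Wtwo F) (hD : IsDerivation D) :
    (∀ x ∈ S2 F, D x ∈ S2 F) ∧ (∀ x ∈ W2sub F, D x ∈ W2sub F) := by
  obtain ⟨A, hA⟩ := hD.exists_eq_wmul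
  constructor
  · have : S2 F ≤ (S2 F).comap D := Submodule.span_le.2 fun x hx => by
      simpa [hA] using wmul_mem_S2 A hx
    exact this
  · have : W2sub F ≤ (W2sub F).comap D := Submodule.span_le.2 fun x hx => by
      simpa [hA] using wmul_mem_W2sub A hx
    exact this
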